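/- arXiv:1210.3256 — 2 statements merged into one kernel-verified Lean document; each statement's English description precedes it below -/
import Mathlib

section
/- For every n with 2 ≤ n < ∞ and every t ∈ ℝ there is a unique *-automorphism ρⁿ_t of the Cuntz algebra O_n such that ρⁿ_t(S_k) = n^{it} S_k for k = 1,…,n. Moreover t ↦ ρⁿ_t is a one-parameter group of *-automorphisms (ρⁿ_{s+t} = ρⁿ_s ∘ ρⁿ_t, ρⁿ_0 = id), for every a ∈ O_n the map t ↦ ρⁿ_t(a) is norm continuous, and the fixed-point algebra {x ∈ O_n : ρⁿ_t(x) = x for all t ∈ ℝ} equals F_n. -/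
open scoped ComplexOrder

/-- The word `S_μ = S_{μ₁} ⋯ S_{μ_k}` associated to a multi-index `μ`. -/
def cuntzWord {A : Type*} [Monoid A] {n : ℕ} (S : Fin n → A) (μ : List (Fin n)) : A :=
  (μ.map S).prod

/-- `F_n^k`: the C*-subalgebra generated by the words `S_μ S_ν*` with `|μ| = |ν| = k`. -/
def cuntzFnk {A : Type*} [CStarAlgebra A] {n : ℕ} (S : Fin n → A) (k : ℕ) :
    StarSubalgebra ℂ A :=
  (StarAlgebra.adjoin ℂ {x : A | ∃ μ ν : List (Fin n),
    μ.length = k ∧ ν.length = k ∧ x = cuntzWord S μ * star (cuntzWord S ν)}).topologicalClosure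

/-- `F_n`: the C*-subalgebra generated by all the words `S_μ S_ν*` with `|μ| = |ν|`. -/
def cuntzFn {A : Type*} [CStarAlgebra A] {n : ℕ} (S : Fin n → A) : StarSubalgebra ℂ A :=
  (StarAlgebra.adjoin ℂ {x : A | ∃ μ ν : List (Fin n),
    μ.length = ν.length ∧ x = cuntzWord S μ * star (cuntzWord S ν)}).topologicalClosure

/-- A state on a C*-algebra: a positive continuous linear functional of norm one. -/
def IsState {A : Type*} [CStarAlgebra A] (f : A →L[ℂ] ℂ) : Prop :=
  ‖f‖ = 1 ∧ ∀ a : A, 0 ≤ f (star a * a)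

/-- The defining property of the canonical state `φ_n` on `O_n`:
`φ_n(S_μ S_ν*) = n^{-|μ|} δ_{μν}`. -/
def IsCuntzState {A : Type*} [CStarAlgebra A] {n : ℕ} (S : Fin n → A)
    (φ : A →L[ℂ] ℂ) : Prop :=
  IsState φ ∧ ∀ μ ν : List (Fin n),
    φ (cuntzWord S μ * star (cuntzWord S ν)) =
      if μ = ν then ((n : ℂ) ^ μ.length)⁻¹ else 0

open MeasureTheory

section CuntzFamily

variable {A : Type*} [CStarAlgebra A] {n : ℕ} {S : Fin n → A}

theorem cuntzWord_cons {M : Type*} [Monoid M] (S : Fin n → M) (i : Fin n) (μ : List (Fin n)) :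
    cuntzWord S (i :: μ) = S i * cuntzWord S μ := by
  simp [cuntzWord]

theorem cuntzWord_append {M : Type*} [Monoid M] (S : Fin n → M) (μ ν : List (Fin n)) :
    cuntzWord S (μ ++ ν) = cuntzWord S μ * cuntzWord S ν := by
  simp [cuntzWord]

theorem star_mul_eq_zero_of_ne (hiso : ∀ i, star (S i) * S i = 1)
    (hsum : ∑ i, S i * star (S i) = 1) {i j : Fin n} (hij : i ≠ j) :
    star (S i) * S j = 0 := by
  let _ := CStarAlgebra.spectralOrder A
  have _ := CStarAlgebra.spectralOrderedRing A
  have hterm (k : Fin n) : 0 ≤ star (star (S k) * S j) * (star (S k) * S j) :=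
    star_mul_self_nonneg _
  have htotal : ∑ k, star (star (S k) * S j) * (star (S k) * S j) = 1 := by
    calc _ = star (S j) * (∑ k, S k * star (S k)) * S j := by
          simp [Finset.mul_sum, Finset.sum_mul, mul_assoc]
      _ = 1 := by rw [hsum, mul_one, hiso]
  have hrest : ∑ k ∈ Finset.univ.erase j, star (star (S k) * S j) * (star (S k) * S j) = 0 := by
    rw [← Finset.add_sum_erase _ _ (Finset.mem_univ j)] at htotal
    rw [hiso, star_one, one_mul] at htotal
    exact add_eq_left.1 htotal
  have hzero := (Finset.sum_eq_zero_iff_of_nonneg fun k _ => hterm k).1 hrest i (by simp [hij])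
  exact CStarRing.star_mul_self_eq_zero_iff _ |>.1 hzero

/-- The canonical endomorphism `x ↦ ∑ S_i x S_i*`. -/
def cuntzShift (S : Fin n → A) (x : A) : A := ∑ i, S i * x * star (S i)

theorem cuntzShift_mul_generator (hiso : ∀ i, star (S i) * S i = 1)
    (hsum : ∑ i, S i * star (S i) = 1) (x : A) (i : Fin n) :
    cuntzShift S x * S i = S i * x := by
  rw [cuntzShift, Finset.sum_mul, Finset.sum_eq_single i]
  · rw [mul_assoc, hiso, mul_one]
  · intro j _ hj
    rw [mul_assoc, star_mul_eq_zero_of_ne hiso hsum hj, mul_zero]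
  · simp

theorem cuntzShift_star (x : A) : cuntzShift S (star x) = star (cuntzShift S x) := by
  simp [cuntzShift, mul_assoc]

theorem cuntzShift_mul (hiso : ∀ i, star (S i) * S i = 1)
    (hsum : ∑ i, S i * star (S i) = 1) (x y : A) :
    cuntzShift S (x * y) = cuntzShift S x * cuntzShift S y := by
  conv_rhs => rw [cuntzShift.eq_def S y, Finset.mul_sum]
  simp_rw [← mul_assoc, cuntzShift_mul_generator hiso hsum]
  simp [cuntzShift, mul_assoc]

theorem cuntzShift_zero : cuntzShift S 0 = 0 := by
  simp [cuntzShift]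

theorem cuntzShift_one (hsum : ∑ i, S i * star (S i) = 1) : cuntzShift S 1 = 1 := by
  simpa [cuntzShift] using hsum

theorem cuntzShift_iterate_star (p : ℕ) (x : A) :
    (cuntzShift S)^[p] (star x) = star ((cuntzShift S)^[p] x) := by
  induction p generalizing x with
  | zero => rfl
  | succ p ih => rw [Function.iterate_succ_apply, cuntzShift_star, ih, Function.iterate_succ_apply]

theorem cuntzShift_iterate_mul (hiso : ∀ i, star (S i) * S i = 1)
    (hsum : ∑ i, S i * star (S i) = 1) (p : ℕ) (x y : A) :
    (cuntzShift S)^[p] (x * y) = (cuntzShift S)^[p] x * (cuntzShift S)^[p] y := by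
  induction p generalizing x y with
  | zero => rfl
  | succ p ih => simp only [Function.iterate_succ_apply, cuntzShift_mul hiso hsum, ih]

theorem cuntzShift_iterate_zero (p : ℕ) : (cuntzShift S)^[p] 0 = 0 :=
  Function.iterate_fixed cuntzShift_zero p

theorem cuntzShift_iterate_one (hsum : ∑ i, S i * star (S i) = 1) (p : ℕ) :
    (cuntzShift S)^[p] 1 = 1 :=
  Function.iterate_fixed (cuntzShift_one hsum) p

theorem cuntzShift_iterate_mul_word (hiso : ∀ i, star (S i) * S i = 1)
    (hsum : ∑ i, S i * star (S i) = 1) (p : ℕ) (x : A) (μ : List (Fin n)) :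
    (cuntzShift S)^[p + μ.length] x * cuntzWord S μ = cuntzWord S μ * (cuntzShift S)^[p] x := by
  induction μ with
  | nil => simp [cuntzWord]
  | cons i μ ih =>
    rw [cuntzWord_cons, List.length_cons, ← add_assoc, Function.iterate_succ_apply', ← mul_assoc,
      cuntzShift_mul_generator hiso hsum, mul_assoc, ih, mul_assoc]

theorem star_cuntzWord_mul_self (hiso : ∀ i, star (S i) * S i = 1) (μ : List (Fin n)) :
    star (cuntzWord S μ) * cuntzWord S μ = 1 := by
  induction μ with
  | nil => simp [cuntzWord]
  | cons i μ ih =>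
    rw [cuntzWord_cons, star_mul, mul_assoc, ← mul_assoc (star (S i)), hiso, one_mul, ih]

/-- The word `S_a^k S_b` is orthogonal to its images under the first `k` shifts. -/
theorem star_shift_iterate_mul_eq_zero (hiso : ∀ i, star (S i) * S i = 1)
    (hsum : ∑ i, S i * star (S i) = 1) {a b : Fin n} (hab : a ≠ b) {k d : ℕ} (hd : 0 < d)
    (hdk : d ≤ k) :
    star ((cuntzShift S)^[d] (cuntzWord S (List.replicate k a ++ [b]))) *
      cuntzWord S (List.replicate k a ++ [b]) = 0 := by
  obtain ⟨e, rfl⟩ := Nat.exists_eq_add_of_le' hdk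
  obtain ⟨d, rfl⟩ := Nat.exists_eq_succ_of_ne_zero hd.ne'
  set g := cuntzWord S (List.replicate (e + (d + 1)) a ++ [b]) with hg
  have hleft : g = cuntzWord S (List.replicate (d + 1) a) *
      (cuntzWord S (List.replicate e a) * S b) := by
    rw [hg, add_comm e, List.replicate_add, List.append_assoc, cuntzWord_append, cuntzWord_append]
    simp [cuntzWord]
  have hright : g = cuntzWord S (List.replicate e a) *
      (S a * (cuntzWord S (List.replicate d a) * S b)) := by
    rw [hg, List.replicate_add, List.append_assoc, cuntzWord_append, cuntzWord_append,
      List.replicate_succ, cuntzWord_cons]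
    simp [cuntzWord, mul_assoc]
  have hshift := cuntzShift_iterate_mul_word hiso hsum 0 (star g) (List.replicate (d + 1) a)
  rw [List.length_replicate, zero_add, Function.iterate_zero_apply] at hshift
  have hzero : star g * (cuntzWord S (List.replicate e a) * S b) = 0 := by
    rw [hright, star_mul, mul_assoc, ← mul_assoc (star (cuntzWord S (List.replicate e a))),
      star_cuntzWord_mul_self hiso, one_mul, star_mul, mul_assoc,
      star_mul_eq_zero_of_ne hiso hsum hab, mul_zero]
  calc _ = (cuntzShift S)^[d + 1] (star g) * g := by rw [cuntzShift_iterate_star]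
    _ = (cuntzShift S)^[d + 1] (star g) * (cuntzWord S (List.replicate (d + 1) a) *
        (cuntzWord S (List.replicate e a) * S b)) := by rw [← hleft]
    _ = 0 := by rw [← mul_assoc, hshift, mul_assoc, hzero, mul_zero]

theorem star_shift_iterate_mul_shift_iterate_eq_zero (hiso : ∀ i, star (S i) * S i = 1)
    (hsum : ∑ i, S i * star (S i) = 1) {a b : Fin n} (hab : a ≠ b) {k p q : ℕ} (hpq : p ≠ q)
    (hp : p ≤ k) (hq : q ≤ k) :
    star ((cuntzShift S)^[p] (cuntzWord S (List.replicate k a ++ [b]))) *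
      (cuntzShift S)^[q] (cuntzWord S (List.replicate k a ++ [b])) = 0 := by
  wlog h : q < p generalizing p q
  · have := this hpq.symm hq hp (by omega)
    rw [← star_eq_zero]
    simpa using this
  obtain ⟨d, rfl⟩ := Nat.exists_eq_add_of_le h.le
  rw [Function.iterate_add_apply, ← cuntzShift_iterate_star, ← cuntzShift_iterate_mul hiso hsum,
    star_shift_iterate_mul_eq_zero hiso hsum hab (by omega) (by omega), cuntzShift_iterate_zero]

/-- The isometry whose compression annihilates the words of nonzero degree and fixes those of
degree zero, among the words `S_μ S_ν*` with `|μ|, |ν| ≤ k`. -/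
def cuntzCompressor (S : Fin n → A) (a b : Fin n) (k : ℕ) : A :=
  (cuntzShift S)^[k] (cuntzWord S (List.replicate k a ++ [b]))

theorem star_cuntzCompressor_mul_self (hiso : ∀ i, star (S i) * S i = 1)
    (hsum : ∑ i, S i * star (S i) = 1) (a b : Fin n) (k : ℕ) :
    star (cuntzCompressor S a b k) * cuntzCompressor S a b k = 1 := by
  rw [cuntzCompressor, ← cuntzShift_iterate_star, ← cuntzShift_iterate_mul hiso hsum,
    star_cuntzWord_mul_self hiso, cuntzShift_iterate_one hsum]

theorem cuntzCompressor_compress_word (hiso : ∀ i, star (S i) * S i = 1)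
    (hsum : ∑ i, S i * star (S i) = 1) {a b : Fin n} (hab : a ≠ b) {k : ℕ}
    {μ ν : List (Fin n)} (hμ : μ.length ≤ k) (hν : ν.length ≤ k) :
    star (cuntzCompressor S a b k) * (cuntzWord S μ * star (cuntzWord S ν)) *
      cuntzCompressor S a b k =
      if μ.length = ν.length then cuntzWord S μ * star (cuntzWord S ν) else 0 := by
  set g := cuntzWord S (List.replicate k a ++ [b]) with hg
  have hleft : star (cuntzCompressor S a b k) * cuntzWord S μ =
      cuntzWord S μ * star ((cuntzShift S)^[k - μ.length] g) := by
    have := cuntzShift_iterate_mul_word hiso hsum (k - μ.length) (star g) μ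
    rwa [Nat.sub_add_cancel hμ, cuntzShift_iterate_star, cuntzShift_iterate_star] at this
  have hright : star (cuntzWord S ν) * cuntzCompressor S a b k =
      (cuntzShift S)^[k - ν.length] g * star (cuntzWord S ν) := by
    have := congrArg star (cuntzShift_iterate_mul_word hiso hsum (k - ν.length) (star g) ν)
    rw [Nat.sub_add_cancel hν, cuntzShift_iterate_star, cuntzShift_iterate_star] at this
    simpa [cuntzCompressor] using this
  calc _ = (star (cuntzCompressor S a b k) * cuntzWord S μ) *
        (star (cuntzWord S ν) * cuntzCompressor S a b k) := by simp only [mul_assoc]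
    _ = cuntzWord S μ * (star ((cuntzShift S)^[k - μ.length] g) *
        (cuntzShift S)^[k - ν.length] g) * star (cuntzWord S ν) := by
      rw [hleft, hright]; simp only [mul_assoc]
    _ = _ := by
      split_ifs with h
      · rw [h, ← cuntzShift_iterate_star, ← cuntzShift_iterate_mul hiso hsum,
          star_cuntzWord_mul_self hiso, cuntzShift_iterate_one hsum, mul_one]
      · rw [star_shift_iterate_mul_shift_iterate_eq_zero hiso hsum hab (by omega) (by omega)
          (by omega), mul_zero, zero_mul]

theorem mem_span_words_of_mem_adjoin (hiso : ∀ i, star (S i) * S i = 1)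
    (hsum : ∑ i, S i * star (S i) = 1) {x : A} (hx : x ∈ StarAlgebra.adjoin ℂ (Set.range S)) :
    x ∈ Submodule.span ℂ
      {y : A | ∃ μ ν : List (Fin n), y = cuntzWord S μ * star (cuntzWord S ν)} := by
  set M := Submodule.span ℂ
    {y : A | ∃ μ ν : List (Fin n), y = cuntzWord S μ * star (cuntzWord S ν)} with hM
  have extend (c : A) (hc : ∀ μ ν : List (Fin n), c * (cuntzWord S μ * star (cuntzWord S ν)) ∈ M)
      (m : A) (hm : m ∈ M) : c * m ∈ M := by
    induction hm using Submodule.span_induction with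
    | mem y hy => obtain ⟨μ, ν, rfl⟩ := hy; exact hc μ ν
    | zero => simp
    | add y z _ _ hy hz => rw [mul_add]; exact add_mem hy hz
    | smul r y _ hy => rw [mul_smul_comm]; exact M.smul_mem r hy
  have word_mem (μ ν : List (Fin n)) : cuntzWord S μ * star (cuntzWord S ν) ∈ M :=
    Submodule.subset_span ⟨μ, ν, rfl⟩
  have generator_mul (i : Fin n) (m : A) (hm : m ∈ M) : S i * m ∈ M := by
    refine extend (S i) (fun μ ν => ?_) m hm
    rw [← mul_assoc, ← cuntzWord_cons]
    exact word_mem _ _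
  have star_generator_mul (i : Fin n) (m : A) (hm : m ∈ M) : star (S i) * m ∈ M := by
    refine extend (star (S i)) (fun μ ν => ?_) m hm
    cases μ with
    | nil =>
      convert word_mem [] (ν ++ [i]) using 1
      rw [cuntzWord_append]
      simp [cuntzWord]
    | cons j μ =>
      rw [cuntzWord_cons, ← mul_assoc, ← mul_assoc]
      by_cases hij : i = j
      · subst hij
        rw [hiso, one_mul]
        exact word_mem _ _
      · rw [star_mul_eq_zero_of_ne hiso hsum hij]
        simp
  have hmul : ∀ m ∈ M, x * m ∈ M := by
    change x ∈ Algebra.adjoin ℂ (Set.range S ∪ star (Set.range S)) at hx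
    induction hx using Algebra.adjoin_induction with
    | mem y hy =>
      rcases hy with ⟨i, rfl⟩ | ⟨i, hi⟩
      · exact generator_mul i
      · rw [← star_star y, ← hi]
        exact star_generator_mul i
    | algebraMap r =>
      intro m hm
      rw [← Algebra.smul_def]
      exact M.smul_mem r hm
    | add y z _ _ hy hz =>
      intro m hm
      rw [add_mul]
      exact add_mem (hy m hm) (hz m hm)
    | mul y z _ _ hy hz =>
      intro m hm
      rw [mul_assoc]
      exact hy _ (hz m hm)
  have hone : (1 : A) ∈ M := by simpa [cuntzWord] using word_mem [] []
  simpa using hmul 1 hone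

end CuntzFamily

section CircleAverage

variable {A : Type*} [CStarAlgebra A]

/-- The mean of a continuous function on the circle, taken over two turns. -/
noncomputable def circleMean (f : C(Circle, A)) : A :=
  (4 * Real.pi)⁻¹ • ∫ t in (-(2 * Real.pi))..(2 * Real.pi), f (Circle.exp t)

theorem continuous_comp_circleExp (f : C(Circle, A)) : Continuous fun t : ℝ => f (Circle.exp t) :=
  f.continuous.comp Circle.exp.continuous

theorem circleMean_add (f g : C(Circle, A)) : circleMean (f + g) = circleMean f + circleMean g := by
  simp only [circleMean, ContinuousMap.add_apply]
  rw [intervalIntegral.integral_add ((continuous_comp_circleExp f).intervalIntegrable _ _)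
    ((continuous_comp_circleExp g).intervalIntegrable _ _), smul_add]

theorem circleMean_smul (c : ℂ) (f : C(Circle, A)) : circleMean (c • f) = c • circleMean f := by
  simp only [circleMean, ContinuousMap.smul_apply]
  rw [intervalIntegral.integral_smul, smul_comm]

theorem circleMean_const (x : A) (f : C(Circle, A)) (hf : ∀ z, f z = x) : circleMean f = x := by
  simp only [circleMean, hf, intervalIntegral.integral_const, smul_smul]
  rw [show (4 * Real.pi)⁻¹ * (2 * Real.pi - -(2 * Real.pi)) = 1 by
    field_simp; norm_num, one_smul]

theorem continuous_circleMean : Continuous (circleMean (A := A)) := by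
  unfold circleMean
  refine Continuous.const_smul ?_ _
  refine intervalIntegral.continuous_parametric_intervalIntegral_of_continuous' ?_ _ _
  simp only [Function.uncurry_def]
  fun_prop

theorem circleMean_pow_smul (x : A) {m : ℤ} (hm : m ≠ 0) (f : C(Circle, A))
    (hf : ∀ z : Circle, f z = ((z ^ m : Circle) : ℂ) • x) : circleMean f = 0 := by
  have hm' : (m : ℂ) * Complex.I ≠ 0 := by simp [hm]
  have hexp (t : ℝ) : ((Circle.exp t ^ m : Circle) : ℂ) = Complex.exp (m * Complex.I * t) := by
    rw [Circle.coe_zpow, Circle.coe_exp, ← Complex.exp_int_mul]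
    ring_nf
  simp only [circleMean, hf, hexp]
  rw [intervalIntegral.integral_smul_const, integral_exp_mul_complex hm']
  have h₁ : Complex.exp (m * Complex.I * ((2 * Real.pi : ℝ) : ℂ)) = 1 :=
    Complex.exp_eq_one_iff.2 ⟨m, by push_cast; ring⟩
  have h₂ : Complex.exp (m * Complex.I * ((-(2 * Real.pi) : ℝ) : ℂ)) = 1 :=
    Complex.exp_eq_one_iff.2 ⟨-m, by push_cast; ring⟩
  rw [h₁, h₂]
  simp

theorem eq_zero_of_circleMean_star_mul_self_eq_zero {f : C(Circle, A)}
    (h : circleMean (star f * f) = 0) : f = 0 := by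
  let _ := CStarAlgebra.spectralOrder A
  have _ := CStarAlgebra.spectralOrderedRing A
  set g : ℝ → A := fun t => star (f (Circle.exp t)) * f (Circle.exp t) with hg
  have hcont : Continuous g :=
    (continuous_comp_circleExp f).star.mul (continuous_comp_circleExp f)
  have g_int (a b : ℝ) : IntervalIntegrable g volume a b := hcont.intervalIntegrable a b
  have hnonneg {a b : ℝ} (hab : a ≤ b) : 0 ≤ ∫ t in a..b, g t := by
    rw [intervalIntegral.integral_of_le hab]
    exact integral_nonneg fun t => star_mul_self_nonneg _
  have htotal : ∫ t in (-(2 * Real.pi))..(2 * Real.pi), g t = 0 := by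
    have hpi : (4 * Real.pi)⁻¹ ≠ 0 := by positivity
    exact (smul_eq_zero.1 h).resolve_left hpi
  have hprimitive (s : ℝ) (hs : s ∈ Set.Ioo (-(2 * Real.pi)) (2 * Real.pi)) :
      ∫ t in (-(2 * Real.pi))..s, g t = 0 := by
    rw [← intervalIntegral.integral_add_adjacent_intervals (g_int _ s) (g_int s _)] at htotal
    exact ((add_eq_zero_iff_of_nonneg (hnonneg hs.1.le) (hnonneg hs.2.le)).1 htotal).1
  ext z
  have harg : Complex.arg z ∈ Set.Ioo (-(2 * Real.pi)) (2 * Real.pi) :=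
    ⟨by linarith [Complex.neg_pi_lt_arg (z : ℂ), Real.pi_pos],
      by linarith [Complex.arg_le_pi (z : ℂ), Real.pi_pos]⟩
  have hderiv := intervalIntegral.integral_hasDerivAt_right (g_int (-(2 * Real.pi)) (Complex.arg z))
    (hcont.stronglyMeasurableAtFilter _ _) hcont.continuousAt
  have hzero : HasDerivAt (fun u => ∫ t in (-(2 * Real.pi))..u, g t) 0 (Complex.arg z) := by
    refine (hasDerivAt_const (Complex.arg z : ℝ) (0 : A)).congr_of_eventuallyEq ?_
    filter_upwards [Ioo_mem_nhds harg.1 harg.2] with s hs using hprimitive s hs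
  have := hderiv.unique hzero
  simp only [hg, Circle.exp_arg] at this
  exact (CStarRing.star_mul_self_eq_zero_iff _).1 this

end CircleAverage

section GaugeLift

variable {A : Type*} [CStarAlgebra A] {n : ℕ}

/-- The Cuntz family `z ↦ z S_i` of continuous functions on the circle. -/
noncomputable def gaugeLift (S : Fin n → A) (i : Fin n) : C(Circle, A) where
  toFun z := (z : ℂ) • S i
  continuous_toFun := by fun_prop

variable {S : Fin n → A}

theorem gaugeLift_apply (i : Fin n) (z : Circle) : gaugeLift S i z = (z : ℂ) • S i := rfl

theorem star_gaugeLift_mul_self (hiso : ∀ i, star (S i) * S i = 1) (i : Fin n) :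
    star (gaugeLift S i) * gaugeLift S i = 1 := by
  ext z
  have hz : (z : ℂ) * (starRingEnd ℂ) z = 1 := by rw [Complex.mul_conj]; simp
  simp [gaugeLift_apply, smul_smul, hz, hiso]

theorem sum_gaugeLift_mul_star (hsum : ∑ i, S i * star (S i) = 1) :
    ∑ i, gaugeLift S i * star (gaugeLift S i) = 1 := by
  ext z
  have hz : (starRingEnd ℂ) z * (z : ℂ) = 1 := by rw [mul_comm, Complex.mul_conj]; simp
  simp [ContinuousMap.sum_apply, gaugeLift_apply, smul_smul, hz, hsum]

theorem cuntzWord_gaugeLift_apply (μ : List (Fin n)) (z : Circle) :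
    cuntzWord (gaugeLift S) μ z = ((z ^ μ.length : Circle) : ℂ) • cuntzWord S μ := by
  induction μ with
  | nil => simp [cuntzWord]
  | cons i μ ih =>
    rw [cuntzWord_cons, ContinuousMap.mul_apply, ih, gaugeLift_apply, cuntzWord_cons,
      smul_mul_smul_comm, List.length_cons, pow_succ', Circle.coe_mul]

theorem gaugeLift_word_apply (μ ν : List (Fin n)) (z : Circle) :
    (cuntzWord (gaugeLift S) μ * star (cuntzWord (gaugeLift S) ν)) z =
      ((z ^ ((μ.length : ℤ) - ν.length) : Circle) : ℂ) •
        (cuntzWord S μ * star (cuntzWord S ν)) := by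
  rw [ContinuousMap.mul_apply, ContinuousMap.star_apply, cuntzWord_gaugeLift_apply,
    cuntzWord_gaugeLift_apply, star_smul, smul_mul_smul_comm, zpow_sub, zpow_natCast, zpow_natCast,
    Circle.coe_mul, Circle.coe_inv_eq_conj]
  rfl

theorem circleMean_gaugeLift_word (μ ν : List (Fin n)) :
    circleMean (cuntzWord (gaugeLift S) μ * star (cuntzWord (gaugeLift S) ν)) =
      if μ.length = ν.length then cuntzWord S μ * star (cuntzWord S ν) else 0 := by
  split_ifs with h
  · refine circleMean_const _ _ fun z => ?_
    rw [gaugeLift_word_apply, h]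
    simp
  · exact circleMean_pow_smul _ (m := (μ.length : ℤ) - ν.length) (by omega) _
      (gaugeLift_word_apply μ ν)

variable (S) in
/-- The C*-algebra of continuous `A`-valued functions generated by the functions `z ↦ z S_i`. -/
noncomputable abbrev gaugeLiftAlgebra : StarSubalgebra ℂ C(Circle, A) :=
  (StarAlgebra.adjoin ℂ (Set.range (gaugeLift S))).topologicalClosure

theorem circleMean_mem_cuntzFn (hiso : ∀ i, star (S i) * S i = 1)
    (hsum : ∑ i, S i * star (S i) = 1) {f : C(Circle, A)} (hf : f ∈ gaugeLiftAlgebra S) :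
    circleMean f ∈ cuntzFn S := by
  have hclosed : IsClosed {f : C(Circle, A) | circleMean f ∈ cuntzFn S} :=
    (StarSubalgebra.isClosed_topologicalClosure _).preimage continuous_circleMean
  refine closure_minimal (fun f hf => ?_) hclosed hf
  have hspan := mem_span_words_of_mem_adjoin (star_gaugeLift_mul_self hiso)
    (sum_gaugeLift_mul_star hsum) hf
  rw [Set.mem_ofPred_eq]
  clear hf
  induction hspan using Submodule.span_induction with
  | mem y hy =>
    obtain ⟨μ, ν, rfl⟩ := hy
    rw [circleMean_gaugeLift_word]
    split_ifs with h
    · exact StarSubalgebra.le_topologicalClosure _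
        (StarAlgebra.subset_adjoin ℂ _ ⟨μ, ν, h, rfl⟩)
    · exact zero_mem _
  | zero => rw [circleMean_const 0 0 fun _ => rfl]; exact zero_mem _
  | add y z _ _ hy hz => rw [circleMean_add]; exact add_mem hy hz
  | smul c y _ hy => rw [circleMean_smul]; exact SMulMemClass.smul_mem c hy

theorem norm_circleMean_le (hn : 2 ≤ n) (hiso : ∀ i, star (S i) * S i = 1)
    (hsum : ∑ i, S i * star (S i) = 1) {f : C(Circle, A)} (hf : f ∈ gaugeLiftAlgebra S) :
    ‖circleMean f‖ ≤ ‖f 1‖ := by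
  have hclosed : IsClosed {f : C(Circle, A) | ‖circleMean f‖ ≤ ‖f 1‖} :=
    isClosed_le continuous_circleMean.norm (continuous_eval_const (1 : Circle)).norm
  refine closure_minimal (fun f hf => ?_) hclosed hf
  have hspan := mem_span_words_of_mem_adjoin (star_gaugeLift_mul_self hiso)
    (sum_gaugeLift_mul_star hsum) hf
  let a : Fin n := ⟨0, by omega⟩
  let b : Fin n := ⟨1, by omega⟩
  have hab : a ≠ b := by simp [a, b]
  have hcompress : ∃ K : ℕ, ∀ k ≥ K,
      star (cuntzCompressor S a b k) * f 1 * cuntzCompressor S a b k = circleMean f := by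
    clear hf
    induction hspan using Submodule.span_induction with
    | mem y hy =>
      obtain ⟨μ, ν, rfl⟩ := hy
      refine ⟨max μ.length ν.length, fun k hk => ?_⟩
      rw [circleMean_gaugeLift_word, gaugeLift_word_apply, one_zpow, Circle.coe_one, one_smul]
      exact cuntzCompressor_compress_word hiso hsum hab (le_of_max_le_left hk)
        (le_of_max_le_right hk)
    | zero => exact ⟨0, fun k _ => by rw [circleMean_const 0 0 fun _ => rfl]; simp⟩
    | add y z _ _ hy hz =>
      obtain ⟨K, hK⟩ := hy
      obtain ⟨L, hL⟩ := hz
      refine ⟨max K L, fun k hk => ?_⟩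
      rw [circleMean_add, ← hK k (le_of_max_le_left hk), ← hL k (le_of_max_le_right hk),
        ContinuousMap.add_apply, mul_add, add_mul]
    | smul c y _ hy =>
      obtain ⟨K, hK⟩ := hy
      refine ⟨K, fun k hk => ?_⟩
      rw [circleMean_smul, ← hK k hk, ContinuousMap.smul_apply, mul_smul_comm, smul_mul_assoc]
  obtain ⟨k, hk⟩ := hcompress
  have hW : ‖cuntzCompressor S a b k‖ ≤ 1 := by
    have h := CStarRing.norm_star_mul_self (x := cuntzCompressor S a b k)
    rw [star_cuntzCompressor_mul_self hiso hsum] at h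
    have h_one : ‖(1 : A)‖ ≤ 1 := by
      have := CStarRing.norm_star_mul_self (x := (1 : A))
      rw [star_one, one_mul] at this
      nlinarith [norm_nonneg (1 : A), sq_nonneg (‖(1 : A)‖ - 1)]
    nlinarith [norm_nonneg (cuntzCompressor S a b k)]
  rw [Set.mem_ofPred_eq, ← hk k le_rfl]
  calc _ ≤ ‖star (cuntzCompressor S a b k)‖ * ‖f 1‖ * ‖cuntzCompressor S a b k‖ :=
        norm_mul₃_le
    _ ≤ 1 * ‖f 1‖ * 1 := by
      rw [norm_star]
      gcongr
    _ = ‖f 1‖ := by ring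

theorem eq_zero_of_mem_gaugeLiftAlgebra (hn : 2 ≤ n) (hiso : ∀ i, star (S i) * S i = 1)
    (hsum : ∑ i, S i * star (S i) = 1) {f : C(Circle, A)} (hf : f ∈ gaugeLiftAlgebra S)
    (h : f 1 = 0) : f = 0 := by
  refine eq_zero_of_circleMean_star_mul_self_eq_zero (norm_le_zero_iff.1 ?_)
  refine (norm_circleMean_le hn hiso hsum (mul_mem (star_mem hf) hf)).trans ?_
  simp [h]

theorem starAlgHom_ext_of_topologicalClosure_eq_top {B : Type*} [CStarAlgebra B]
    (hgen : (StarAlgebra.adjoin ℂ (Set.range S)).topologicalClosure = ⊤) {φ ψ : A →⋆ₐ[ℂ] B}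
    (h : ∀ k, φ (S k) = ψ (S k)) : φ = ψ := by
  have hφ : Continuous φ :=
    (NonUnitalStarAlgHom.instContinuousLinearMapClassComplex (F := A →⋆ₐ[ℂ] B)).map_continuous φ
  have hψ : Continuous ψ :=
    (NonUnitalStarAlgHom.instContinuousLinearMapClassComplex (F := A →⋆ₐ[ℂ] B)).map_continuous ψ
  have hadjoin : StarAlgebra.adjoin ℂ (Set.range S) ≤ StarAlgHom.equalizer φ ψ :=
    StarAlgHom.adjoin_le_equalizer φ ψ (by rintro _ ⟨k, rfl⟩; exact h k)
  have hclosure := StarSubalgebra.topologicalClosure_minimal hadjoin (isClosed_eq hφ hψ)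
  rw [hgen] at hclosure
  ext x
  exact hclosure (show x ∈ (⊤ : StarSubalgebra ℂ A) from trivial)

/-- Every element of `A` is the value at `1` of a function whose values are the images of the
element under the gauge action. -/
theorem exists_gauge_starAlgHom (hn : 2 ≤ n) (hiso : ∀ i, star (S i) * S i = 1)
    (hsum : ∑ i, S i * star (S i) = 1)
    (hgen : (StarAlgebra.adjoin ℂ (Set.range S)).topologicalClosure = ⊤) :
    ∃ Φ : A →⋆ₐ[ℂ] C(Circle, A),
      (∀ k, Φ (S k) = gaugeLift S k) ∧ ∀ x, Φ x ∈ gaugeLiftAlgebra S := by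
  let _ : CStarAlgebra (gaugeLiftAlgebra S) := StarSubalgebra.cstarAlgebra _
    (h_closed := StarSubalgebra.isClosed_topologicalClosure _)
  let ev : gaugeLiftAlgebra S →⋆ₐ[ℂ] A :=
    { toFun f := (f : C(Circle, A)) 1
      map_one' := rfl
      map_mul' _ _ := rfl
      map_zero' := rfl
      map_add' _ _ := rfl
      commutes' _ := rfl
      map_star' _ := rfl }
  have hinj : Function.Injective ev := by
    rw [injective_iff_map_eq_zero]
    intro f hf
    exact Subtype.ext (eq_zero_of_mem_gaugeLiftAlgebra hn hiso hsum f.2 hf)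
  have hlift (k : Fin n) : gaugeLift S k ∈ gaugeLiftAlgebra S :=
    StarSubalgebra.le_topologicalClosure _ (StarAlgebra.subset_adjoin ℂ _ ⟨k, rfl⟩)
  have hev (k : Fin n) : ev ⟨gaugeLift S k, hlift k⟩ = S k := by
    change gaugeLift S k 1 = S k
    simp [gaugeLift_apply]
  have hsurj : Function.Surjective ev := by
    have hclosed : IsClosed (ev.range : Set A) :=
      (NonUnitalStarAlgHom.isometry ev hinj).isClosedEmbedding.isClosed_range
    have hle := StarSubalgebra.topologicalClosure_minimal (t := ev.range)
      (StarAlgebra.adjoin_le (Set.range_subset_iff.2 fun k => ⟨_, hev k⟩)) hclosed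
    rw [hgen] at hle
    exact fun x => hle (show x ∈ (⊤ : StarSubalgebra ℂ A) from trivial)
  let e := StarAlgEquiv.ofBijective ev ⟨hinj, hsurj⟩
  refine ⟨(gaugeLiftAlgebra S).subtype.comp (e.symm : A →⋆ₐ[ℂ] gaugeLiftAlgebra S),
    fun k => ?_, fun x => (e.symm x).2⟩
  have : e.symm (S k) = ⟨gaugeLift S k, hlift k⟩ := by
    rw [StarAlgEquiv.symm_apply_eq]
    exact (hev k).symm
  exact congrArg Subtype.val this

end GaugeLift

/-- **(Olesen–Pedersen)** On the Cuntz algebra `O_n` (`n ≥ 2`), for every `t ∈ ℝ` there is a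
unique *-automorphism `ρⁿ_t` with `ρⁿ_t(S_k) = n^{it} S_k`; `t ↦ ρⁿ_t` is a point-norm
continuous one-parameter group of *-automorphisms whose fixed-point algebra is `F_n`. -/
theorem cuntz_gauge_action_exists_unique {A : Type*} [CStarAlgebra A] {n : ℕ} (hn : 2 ≤ n)
    (S : Fin n → A)
    (hiso : ∀ i, star (S i) * S i = 1)
    (hsum : ∑ i, S i * star (S i) = 1)
    (hgen : (StarAlgebra.adjoin ℂ (Set.range S)).topologicalClosure = ⊤) :
    ∃ ρ : ℝ → (A ≃⋆ₐ[ℂ] A),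
      (∀ (t : ℝ) (k : Fin n), ρ t (S k) = Complex.exp (Complex.I * t * Real.log n) • S k) ∧
      (∀ s t : ℝ, ∀ x : A, ρ (s + t) x = ρ s (ρ t x)) ∧
      (∀ x : A, ρ 0 x = x) ∧
      (∀ a : A, Continuous fun t : ℝ => ρ t a) ∧
      ({x : A | ∀ t : ℝ, ρ t x = x} = (cuntzFn S : Set A)) ∧
      (∀ (t : ℝ) (σ : A ≃⋆ₐ[ℂ] A),
        (∀ k : Fin n, σ (S k) = Complex.exp (Complex.I * t * Real.log n) • S k) →
        ∀ x : A, σ x = ρ t x) := by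
  obtain ⟨Φ, hΦ, hmem⟩ := exists_gauge_starAlgHom hn hiso hsum hgen
  let φ (z : Circle) : A →⋆ₐ[ℂ] A :=
    { toFun x := Φ x z
      map_one' := by simp
      map_mul' _ _ := by simp
      map_zero' := by simp
      map_add' _ _ := by simp
      commutes' _ := by simp [Algebra.algebraMap_eq_smul_one]
      map_star' _ := by simp [map_star] }
  have φ_gen (z : Circle) (k : Fin n) : φ z (S k) = (z : ℂ) • S k := by
    change Φ (S k) z = _
    rw [hΦ, gaugeLift_apply]
  have φ_one (x : A) : φ 1 x = x := by
    have : φ 1 = StarAlgHom.id ℂ A :=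
      starAlgHom_ext_of_topologicalClosure_eq_top hgen fun k => by simp [φ_gen]
    rw [this, StarAlgHom.coe_id, id]
  have φ_mul (z w : Circle) (x : A) : φ (z * w) x = φ z (φ w x) := by
    have : φ (z * w) = (φ z).comp (φ w) :=
      starAlgHom_ext_of_topologicalClosure_eq_top hgen fun k => by
        simp [φ_gen, smul_smul, mul_comm]
    rw [this, StarAlgHom.comp_apply]
  have φ_bij (z : Circle) : Function.Bijective (φ z) :=
    Function.bijective_iff_has_inverse.2 ⟨φ z⁻¹, fun x => by rw [← φ_mul]; simp [φ_one],
      fun x => by rw [← φ_mul]; simp [φ_one]⟩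
  have hcoe (t : ℝ) : ((Circle.exp (t * Real.log n) : Circle) : ℂ) =
      Complex.exp (Complex.I * t * Real.log n) := by
    rw [Circle.coe_exp]
    push_cast
    ring_nf
  have hlog : Real.log n ≠ 0 := (Real.log_pos (by exact_mod_cast hn)).ne'
  refine ⟨fun t => StarAlgEquiv.ofBijective (φ (Circle.exp (t * Real.log n))) (φ_bij _),
    fun t k => ?_, fun s t x => ?_, fun x => ?_, fun a => ?_, ?_, fun t σ hσ x => ?_⟩
  · rw [StarAlgEquiv.ofBijective_apply, φ_gen, hcoe]
  · simp only [StarAlgEquiv.ofBijective_apply]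
    rw [add_mul, Circle.exp_add, φ_mul]
  · simp [StarAlgEquiv.ofBijective_apply, φ_one]
  · simp only [StarAlgEquiv.ofBijective_apply]
    change Continuous fun t : ℝ => Φ a (Circle.exp (t * Real.log n))
    fun_prop
  · ext x
    simp only [StarAlgEquiv.ofBijective_apply, Set.mem_ofPred_eq, SetLike.mem_coe]
    constructor
    · intro hx
      rw [← circleMean_const x (Φ x) fun z => ?_]
      · exact circleMean_mem_cuntzFn hiso hsum (hmem x)
      · have := hx (Complex.arg z / Real.log n)
        rwa [div_mul_cancel₀ _ hlog, Circle.exp_arg] at this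
    · intro hx t
      set z := Circle.exp (t * Real.log n)
      have hcont : Continuous (φ z) := (continuous_eval_const z).comp
        ((NonUnitalStarAlgHom.instContinuousLinearMapClassComplex
          (F := A →⋆ₐ[ℂ] C(Circle, A))).map_continuous Φ)
      have hle : cuntzFn S ≤ StarAlgHom.equalizer (φ z) (StarAlgHom.id ℂ A) := by
        refine StarSubalgebra.topologicalClosure_minimal
          (StarAlgHom.adjoin_le_equalizer _ _ ?_) (isClosed_eq hcont continuous_id)
        have φ_word (μ : List (Fin n)) : φ z (cuntzWord S μ) = cuntzWord (gaugeLift S) μ z := by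
          change Φ (cuntzWord S μ) z = _
          simp [cuntzWord, map_list_prod, Function.comp_def, hΦ]
        rintro _ ⟨μ, ν, h, rfl⟩
        rw [map_mul, map_star, φ_word, φ_word, ← ContinuousMap.star_apply,
          ← ContinuousMap.mul_apply, gaugeLift_word_apply, h]
        simp
      exact hle hx
  · rw [StarAlgEquiv.ofBijective_apply]
    have : (σ : A →⋆ₐ[ℂ] A) = φ (Circle.exp (t * Real.log n)) :=
      starAlgHom_ext_of_topologicalClosure_eq_top hgen fun k => by
        rw [φ_gen, hcoe]
        exact hσ k
    exact DFunLike.congr_fun this x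
end

section
/- The relative commutant of F_n in the Cuntz algebra O_n is trivial: (F_n)′ ∩ O_n = ℂ·1, i.e., every x ∈ O_n commuting with all elements of F_n is a scalar multiple of the identity. -/
open scoped ComplexOrder

namespace Cuntz

section Words

variable {A : Type*} [CStarAlgebra A] {n : ℕ} {S : Fin n → A}

@[simp]
lemma word_nil : cuntzWord S [] = 1 := by simp [cuntzWord]

@[simp]
lemma word_cons (i : Fin n) (μ : List (Fin n)) :
    cuntzWord S (i :: μ) = S i * cuntzWord S μ := by simp [cuntzWord]

/-- The generating isometries have mutually orthogonal ranges. -/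
lemma star_mul_eq_zero_of_ne (hiso : ∀ i, star (S i) * S i = 1)
    (hsum : ∑ i, S i * star (S i) = 1) {i j : Fin n} (hij : i ≠ j) :
    star (S i) * S j = 0 := by
  let : PartialOrder A := CStarAlgebra.spectralOrder A
  have : StarOrderedRing A := CStarAlgebra.spectralOrderedRing A
  have hconj : ∑ k, star (star (S k) * S j) * (star (S k) * S j) = 1 := by
    have h : star (S j) * (∑ k, S k * star (S k)) * S j = 1 := by
      rw [hsum, mul_one, hiso]
    rw [← h, Finset.mul_sum, Finset.sum_mul]
    simp [mul_assoc]
  have hrest : ∑ k ∈ Finset.univ.erase j, star (star (S k) * S j) * (star (S k) * S j) = 0 := by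
    have h := Finset.add_sum_erase Finset.univ
      (fun k => star (star (S k) * S j) * (star (S k) * S j)) (Finset.mem_univ j)
    rw [hconj] at h
    simpa only [hiso, star_one, mul_one, add_eq_left] using h
  have hzero := (Finset.sum_eq_zero_iff_of_nonneg fun k _ => star_mul_self_nonneg _).1 hrest i
    (Finset.mem_erase.2 ⟨hij, Finset.mem_univ i⟩)
  exact CStarRing.star_mul_self_eq_zero_iff _ |>.1 hzero

/-- The canonical endomorphism `y ↦ ∑ i, S i * y * star (S i)` of the Cuntz algebra. -/
def canonicalEndomorphism (hiso : ∀ i, star (S i) * S i = 1)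
    (hsum : ∑ i, S i * star (S i) = 1) : A →⋆ₙₐ[ℂ] A where
  toFun y := ∑ i, S i * y * star (S i)
  map_smul' c y := by simp [Finset.smul_sum]
  map_zero' := by simp
  map_add' y z := by simp [mul_add, add_mul, Finset.sum_add_distrib]
  map_mul' y z := by
    rw [Finset.sum_mul_sum]
    refine Finset.sum_congr rfl fun i _ => ?_
    rw [Finset.sum_eq_single i]
    · rw [show S i * y * star (S i) * (S i * z * star (S i))
        = S i * y * (star (S i) * S i) * z * star (S i) by noncomm_ring, hiso]
      noncomm_ring
    · intro j _ hji
      rw [show S i * y * star (S i) * (S j * z * star (S j))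
        = S i * y * (star (S i) * S j) * z * star (S j) by noncomm_ring,
        star_mul_eq_zero_of_ne hiso hsum hji.symm]
      simp
    · simp
  map_star' y := by simp [mul_assoc]

/-- `x` commutes with all the words `S_μ S_ν*` with `|μ| = |ν|`. -/
def CommutesWithWords (S : Fin n → A) (x : A) : Prop :=
  ∀ μ ν : List (Fin n), μ.length = ν.length →
    Commute x (cuntzWord S μ * star (cuntzWord S ν))

lemma CommutesWithWords.sub_smul_one {x : A} (hx : CommutesWithWords S x) (c : ℂ) :
    CommutesWithWords S (x - c • 1) := fun μ ν h =>
  (hx μ ν h).sub_left ((Commute.one_left _).smul_left c)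

lemma CommutesWithWords.compress (hiso : ∀ i, star (S i) * S i = 1) {x : A}
    (hx : CommutesWithWords S x) (i : Fin n) :
    CommutesWithWords S (star (S i) * x * S i) := by
  intro μ ν h
  have hc := hx (i :: μ) (i :: ν) (by simp [h])
  simp only [word_cons, star_mul] at hc
  set w := cuntzWord S μ * star (cuntzWord S ν) with hw
  have hc' : x * (S i * w * star (S i)) = S i * w * star (S i) * x := by
    simpa only [hw, mul_assoc] using hc.eq
  calc star (S i) * x * S i * w
      = star (S i) * x * S i * w * (star (S i) * S i) := by rw [hiso, mul_one]
    _ = star (S i) * (x * (S i * w * star (S i))) * S i := by noncomm_ring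
    _ = (star (S i) * S i) * w * (star (S i) * x * S i) := by rw [hc']; noncomm_ring
    _ = w * (star (S i) * x * S i) := by rw [hiso, one_mul]

lemma CommutesWithWords.canonicalEndomorphism_compress (hiso : ∀ i, star (S i) * S i = 1)
    (hsum : ∑ i, S i * star (S i) = 1) {x : A} (hx : CommutesWithWords S x) (i : Fin n) :
    canonicalEndomorphism hiso hsum (star (S i) * x * S i) = x := by
  change ∑ j, S j * (star (S i) * x * S i) * star (S j) = x
  have h : ∀ j, S j * (star (S i) * x * S i) * star (S j) = x * (S j * star (S j)) := by
    intro j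
    have hc : x * (S j * star (S i)) = S j * star (S i) * x := by
      simpa using (hx [j] [i] rfl).eq
    calc S j * (star (S i) * x * S i) * star (S j)
        = (S j * star (S i) * x) * S i * star (S j) := by noncomm_ring
      _ = x * S j * (star (S i) * S i) * star (S j) := by rw [← hc]; noncomm_ring
      _ = x * (S j * star (S j)) := by rw [hiso]; noncomm_ring
  simp only [h]
  rw [← Finset.mul_sum, hsum, mul_one]

lemma CommutesWithWords.norm_le_norm_compress (hiso : ∀ i, star (S i) * S i = 1)
    (hsum : ∑ i, S i * star (S i) = 1) (μ : List (Fin n)) {x : A}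
    (hx : CommutesWithWords S x) :
    ‖x‖ ≤ ‖star (cuntzWord S μ) * x * cuntzWord S μ‖ := by
  induction μ generalizing x with
  | nil => simp
  | cons i μ ih =>
    calc ‖x‖ = ‖canonicalEndomorphism hiso hsum (star (S i) * x * S i)‖ := by
          rw [hx.canonicalEndomorphism_compress hiso hsum i]
      _ ≤ ‖star (S i) * x * S i‖ := NonUnitalStarAlgHom.norm_apply_le _ _
      _ ≤ _ := ih (hx.compress hiso i)
      _ = _ := by simp only [word_cons, star_mul, mul_assoc]

lemma star_word_mul_word (hiso : ∀ i, star (S i) * S i = 1) (μ : List (Fin n)) :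
    star (cuntzWord S μ) * cuntzWord S μ = 1 := by
  induction μ with
  | nil => simp
  | cons i μ ih =>
    rw [word_cons, star_mul, mul_assoc, ← mul_assoc (star (S i)), hiso, one_mul, ih]

lemma norm_star_word_mul_mul_word_le (hiso : ∀ i, star (S i) * S i = 1) (μ : List (Fin n))
    (y : A) : ‖star (cuntzWord S μ) * y * cuntzWord S μ‖ ≤ ‖y‖ := by
  rcases subsingleton_or_nontrivial A with _ | _
  · simp [Subsingleton.elim _ (0 : A)]
  have hw : ‖cuntzWord S μ‖ = 1 := by
    have h := CStarRing.norm_star_mul_self (x := cuntzWord S μ)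
    rw [star_word_mul_word hiso, CStarRing.norm_one] at h
    nlinarith [norm_nonneg (cuntzWord S μ)]
  calc _ ≤ ‖star (cuntzWord S μ)‖ * ‖y‖ * ‖cuntzWord S μ‖ := norm_mul₃_le
    _ = ‖y‖ := by rw [norm_star, hw]; ring

lemma mem_span_words_of_mem_adjoin (hiso : ∀ i, star (S i) * S i = 1)
    (hsum : ∑ i, S i * star (S i) = 1) {a : A} (ha : a ∈ StarAlgebra.adjoin ℂ (Set.range S)) :
    a ∈ Submodule.span ℂ (Set.range fun p : List (Fin n) × List (Fin n) =>
      cuntzWord S p.1 * star (cuntzWord S p.2)) := by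
  set M := Submodule.span ℂ (Set.range fun p : List (Fin n) × List (Fin n) =>
      cuntzWord S p.1 * star (cuntzWord S p.2))
  have hword : ∀ μ ν, cuntzWord S μ * star (cuntzWord S ν) ∈ M := fun μ ν =>
    Submodule.subset_span ⟨(μ, ν), rfl⟩
  have hgen : ∀ b : A, (∀ μ ν, b * (cuntzWord S μ * star (cuntzWord S ν)) ∈ M) →
      ∀ m ∈ M, b * m ∈ M := by
    intro b hb m hm
    induction hm using Submodule.span_induction with
    | mem m hm => obtain ⟨p, rfl⟩ := hm; exact hb _ _
    | zero => simp
    | add _ _ _ _ h₁ h₂ => rw [mul_add]; exact add_mem h₁ h₂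
    | smul c _ _ h => rw [mul_smul_comm]; exact M.smul_mem c h
  have hstab : ∀ m ∈ M, a * m ∈ M ∧ star a * m ∈ M := by
    induction ha using StarAlgebra.adjoin_induction with
    | mem b hb =>
      obtain ⟨i, rfl⟩ := hb
      refine fun m hm => ⟨hgen _ (fun μ ν => ?_) m hm, hgen _ (fun μ ν => ?_) m hm⟩
      · simpa [mul_assoc] using hword (i :: μ) ν
      · cases μ with
        | nil =>
          have hright : ∀ ν : List (Fin n), cuntzWord S (ν ++ [i]) = cuntzWord S ν * S i := by
            simp [cuntzWord]
          simpa [hright] using hword [] (ν ++ [i])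
        | cons j μ =>
          rw [word_cons, show star (S i) * (S j * cuntzWord S μ * star (cuntzWord S ν))
            = star (S i) * S j * (cuntzWord S μ * star (cuntzWord S ν)) by noncomm_ring]
          by_cases hij : i = j
          · subst hij
            rw [hiso, one_mul]
            exact hword μ ν
          · rw [star_mul_eq_zero_of_ne hiso hsum hij, zero_mul]
            exact M.zero_mem
    | algebraMap c =>
      intro m hm
      rw [← algebraMap_star_comm, ← Algebra.smul_def, ← Algebra.smul_def]
      exact ⟨M.smul_mem _ hm, M.smul_mem _ hm⟩
    | add b c _ _ hb hc =>
      intro m hm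
      rw [star_add, add_mul, add_mul]
      exact ⟨add_mem (hb m hm).1 (hc m hm).1, add_mem (hb m hm).2 (hc m hm).2⟩
    | mul b c _ _ hb hc =>
      intro m hm
      rw [star_mul, mul_assoc, mul_assoc]
      exact ⟨(hb _ (hc m hm).1).1, (hc _ (hb m hm).2).2⟩
    | star b _ hb =>
      intro m hm
      rw [star_star]
      exact (hb m hm).symm
  simpa using (hstab 1 (by simpa using hword [] [])).1

/-- The word `S_i^k S_j`. -/
lemma word_replicate_append (i j : Fin n) (k : ℕ) :
    cuntzWord S (List.replicate k i ++ [j]) = S i ^ k * S j := by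
  simp [cuntzWord]

lemma star_pow_mul_mul_word (hiso : ∀ i, star (S i) * S i = 1)
    (hsum : ∑ i, S i * star (S i) = 1) (i j : Fin n) (μ : List (Fin n)) {k : ℕ}
    (hk : μ.length ≤ k) :
    star (S i ^ k * S j) * cuntzWord S μ = 0 ∨
      ∃ p, star (S i ^ k * S j) * cuntzWord S μ = star (S i ^ p * S j) := by
  induction μ generalizing k with
  | nil => exact Or.inr ⟨k, by simp⟩
  | cons l μ ih =>
    obtain ⟨k, rfl⟩ : ∃ m, k = m + 1 := ⟨k - 1, by simp at hk; omega⟩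
    have h : star (S i ^ (k + 1) * S j) * cuntzWord S (l :: μ)
        = star (S i ^ k * S j) * (star (S i) * S l) * cuntzWord S μ := by
      rw [pow_succ', word_cons]
      simp only [star_mul, mul_assoc]
    rw [h]
    by_cases hl : i = l
    · subst hl
      rw [hiso, mul_one]
      exact ih (by simpa using hk)
    · left
      simp [star_mul_eq_zero_of_ne hiso hsum hl]

lemma star_pow_mul_mul_pow_mul (hiso : ∀ i, star (S i) * S i = 1)
    (hsum : ∑ i, S i * star (S i) = 1) {i j : Fin n} (hij : i ≠ j) (p q : ℕ) :
    star (S i ^ p * S j) * (S i ^ q * S j) = if p = q then 1 else 0 := by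
  induction p generalizing q with
  | zero =>
    cases q with
    | zero => simp [hiso]
    | succ q =>
      rw [pow_zero, one_mul, pow_succ', mul_assoc, ← mul_assoc,
        star_mul_eq_zero_of_ne hiso hsum hij.symm]
      simp
  | succ p ih =>
    cases q with
    | zero =>
      rw [pow_zero, one_mul, pow_succ', star_mul, star_mul, mul_assoc, mul_assoc,
        star_mul_eq_zero_of_ne hiso hsum hij]
      simp
    | succ q =>
      rw [show star (S i ^ (p + 1) * S j) * (S i ^ (q + 1) * S j)
          = star (S i ^ p * S j) * (star (S i) * S i) * (S i ^ q * S j) by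
        rw [pow_succ', pow_succ']
        simp only [star_mul, mul_assoc], hiso, mul_one, ih]
      simp

/-- Compression by the aperiodic word `S_i^k S_j` maps short words to scalars. -/
lemma compress_word_mem_span_one (hiso : ∀ i, star (S i) * S i = 1)
    (hsum : ∑ i, S i * star (S i) = 1) {i j : Fin n} (hij : i ≠ j) (μ ν : List (Fin n)) {k : ℕ}
    (hμ : μ.length ≤ k) (hν : ν.length ≤ k) :
    star (S i ^ k * S j) * (cuntzWord S μ * star (cuntzWord S ν)) * (S i ^ k * S j)
      ∈ Submodule.span ℂ {(1 : A)} := by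
  have h : star (S i ^ k * S j) * (cuntzWord S μ * star (cuntzWord S ν)) * (S i ^ k * S j)
      = star (S i ^ k * S j) * cuntzWord S μ * star (star (S i ^ k * S j) * cuntzWord S ν) := by
    rw [star_mul _ (cuntzWord S ν), star_star]
    simp only [mul_assoc]
  rw [h]
  rcases star_pow_mul_mul_word hiso hsum i j μ hμ with h₁ | ⟨p, h₁⟩
  · rw [h₁, zero_mul]
    exact Submodule.zero_mem _
  rcases star_pow_mul_mul_word hiso hsum i j ν hν with h₂ | ⟨q, h₂⟩
  · rw [h₂, star_zero, mul_zero]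
    exact Submodule.zero_mem _
  rw [h₁, h₂, star_star, star_pow_mul_mul_pow_mul hiso hsum hij]
  split_ifs
  · exact Submodule.mem_span_singleton_self _
  · exact Submodule.zero_mem _

lemma eventually_compress_mem_span_one (hiso : ∀ i, star (S i) * S i = 1)
    (hsum : ∑ i, S i * star (S i) = 1) {i j : Fin n} (hij : i ≠ j) {y : A}
    (hy : y ∈ StarAlgebra.adjoin ℂ (Set.range S)) :
    ∀ᶠ k in Filter.atTop,
      star (S i ^ k * S j) * y * (S i ^ k * S j) ∈ Submodule.span ℂ {(1 : A)} := by
  replace hy := mem_span_words_of_mem_adjoin hiso hsum hy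
  induction hy using Submodule.span_induction with
  | mem m hm =>
    obtain ⟨⟨μ, ν⟩, rfl⟩ := hm
    filter_upwards [Filter.eventually_ge_atTop μ.length, Filter.eventually_ge_atTop ν.length]
      with k hμ hν
    exact compress_word_mem_span_one hiso hsum hij μ ν hμ hν
  | zero => simp
  | add y z _ _ h₁ h₂ =>
    filter_upwards [h₁, h₂] with k h₁ h₂
    rw [mul_add, add_mul]
    exact add_mem h₁ h₂
  | smul c y _ h =>
    filter_upwards [h] with k h
    rw [mul_smul_comm, smul_mul_assoc]
    exact Submodule.smul_mem _ c h

end Words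

end Cuntz

/-- The relative commutant of `F_n` in the Cuntz algebra `O_n` is trivial:
every `x ∈ O_n` commuting with all elements of `F_n` is a scalar multiple of the identity. -/
theorem cuntz_relative_commutant_trivial {A : Type*} [CStarAlgebra A] {n : ℕ} (hn : 2 ≤ n)
    (S : Fin n → A)
    (hiso : ∀ i, star (S i) * S i = 1)
    (hsum : ∑ i, S i * star (S i) = 1)
    (hgen : (StarAlgebra.adjoin ℂ (Set.range S)).topologicalClosure = ⊤)
    (x : A) (hx : ∀ y ∈ cuntzFn S, x * y = y * x) :
    ∃ c : ℂ, x = c • (1 : A) := by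
  have hcomm : Cuntz.CommutesWithWords S x := fun μ ν h =>
    hx _ (StarSubalgebra.le_topologicalClosure _ (StarAlgebra.subset_adjoin ℂ _ ⟨μ, ν, h, rfl⟩))
  let i : Fin n := ⟨0, by omega⟩
  let j : Fin n := ⟨1, by omega⟩
  have hij : i ≠ j := by simp [i, j]
  suffices h : x ∈ Submodule.span ℂ {(1 : A)} by
    obtain ⟨c, hc⟩ := Submodule.mem_span_singleton.1 h
    exact ⟨c, hc.symm⟩
  have hclosed : IsClosed (Submodule.span ℂ {(1 : A)} : Set A) :=
    Submodule.closed_of_finiteDimensional _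
  rw [← SetLike.mem_coe, ← hclosed.closure_eq, Metric.mem_closure_iff]
  intro ε hε
  have hxc : x ∈ closure (StarAlgebra.adjoin ℂ (Set.range S) : Set A) := by
    rw [← StarSubalgebra.topologicalClosure_coe, hgen]
    trivial
  obtain ⟨y, hy, hxy⟩ := Metric.mem_closure_iff.1 hxc ε hε
  obtain ⟨k, hk⟩ := (Cuntz.eventually_compress_mem_span_one hiso hsum hij hy).exists
  obtain ⟨c, hc⟩ := Submodule.mem_span_singleton.1 hk
  refine ⟨c • 1, Submodule.mem_span_singleton.2 ⟨c, rfl⟩, ?_⟩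
  let α := List.replicate k i ++ [j]
  rw [← Cuntz.word_replicate_append] at hc
  rw [dist_eq_norm] at hxy ⊢
  calc ‖x - c • 1‖ ≤ ‖star (cuntzWord S α) * (x - c • 1) * cuntzWord S α‖ :=
        (hcomm.sub_smul_one c).norm_le_norm_compress hiso hsum α
    _ = ‖star (cuntzWord S α) * (x - y) * cuntzWord S α‖ := by
        rw [mul_sub, sub_mul, mul_sub, sub_mul, ← hc, mul_smul_comm, smul_mul_assoc, mul_one,
          Cuntz.star_word_mul_word hiso]
    _ ≤ ‖x - y‖ := Cuntz.norm_star_word_mul_mul_word_le hiso α _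
    _ < ε := hxy
end
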